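/- Let n ≥ 8 be divisible by 4 and d = n/2, and suppose that for every m divisible by 4 with 4 ≤ m < n, every Hamiltonian cycle on the complete graph on ZMod m has circlet cost at least m − 2. Then any Hamiltonian cycle H on ZMod n whose circlet cost is strictly less than n − 2 contains, for every u ∈ ZMod n, none of the following three edge configurations: (Type A) the three edges {u+d, u}, {u, u+1}, {u+1, u+1+d}; (Type B1) the three edges {u+1, u}, {u, u+d}, {u+d, u+1+d}; (Type B2) the three edges {u, u+1}, {u+1, u+1+d}, {u+1+d, u+d}. (All vertex labels taken mod n.) -/

import Mathlib

/-- The length of an edge of the complete graph on `ZMod n`: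
`ℓ(i,j) = min(|i−j|, n−|i−j|)`, expressed as `min (i-j).val (j-i).val`. -/
def zLenSym {n : ℕ} : Sym2 (ZMod n) → ℕ :=
  Sym2.lift ⟨fun i j => min (i - j).val (j - i).val, fun i j => min_comm _ _⟩

/-- The circlet cost of an edge: its length `ℓ` if `ℓ` is odd, and `d − ℓ` if `ℓ` is even. -/
def circCost {n : ℕ} (d : ℕ) (e : Sym2 (ZMod n)) : ℕ :=
  if Odd (zLenSym e) then zLenSym e else d - zLenSym e

/-- column of a vertex -/
def colN (d a : ℕ) : ℕ := if a < d then a else a - d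
/-- colour of a vertex -/
def chiN (d a : ℕ) : ℕ := if a < d then a % 2 else (a + 1) % 2
/-- cost in column/colour coordinates -/
def costN (d a b : ℕ) : ℕ :=
  if chiN d a = chiN d b then d - ((colN d a - colN d b) + (colN d b - colN d a))
  else (colN d a - colN d b) + (colN d b - colN d a)
/-- deletion of two adjacent columns -/
def redN (d a : ℕ) : ℕ := if a < d then a - 2 else a - 4

lemma chiN_lt (d a : ℕ) : chiN d a = 0 ∨ chiN d a = 1 := by
  unfold chiN; split_ifs <;> omega

lemma zmod_val_sub {n : ℕ} [NeZero n] (x y : ZMod n) :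
    (x - y).val = if y.val ≤ x.val then x.val - y.val else x.val + n - y.val := by
  have hx := ZMod.val_lt x
  have hy := ZMod.val_lt y
  split_ifs with h
  · exact ZMod.val_sub h
  · have : x - y = ((x.val + n - y.val : ℕ) : ZMod n) := by
      rw [Nat.cast_sub (by omega)]; simp
    rw [this, ZMod.val_cast_of_lt (by omega)]

lemma circCost_eq {n d : ℕ} [NeZero n] (hnd : n = 2 * d) (hd : d % 2 = 0) (u x y : ZMod n) :
    circCost d s(x, y) = costN d (x - u).val (y - u).val := by
  have h1 : x - y = (x - u) - (y - u) := by ring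
  have h2 : y - x = (y - u) - (x - u) := by ring
  have hx := ZMod.val_lt (x - u)
  have hy := ZMod.val_lt (y - u)
  simp only [circCost, zLenSym, Sym2.lift_mk, h1, h2]
  rw [zmod_val_sub (x - u), zmod_val_sub (y - u)]
  generalize (x - u).val = a at *
  generalize (y - u).val = b at *
  simp only [costN, colN, chiN, Nat.odd_iff]
  subst hnd
  by_cases h : a < d <;> by_cases h' : b < d <;>
    rcases lt_trichotomy a b with h'' | h'' | h'' <;>
    simp only [h, h', if_true, if_false] <;> (try subst h'') <;>
    (try simp only [h''.le, not_le.mpr h'', if_true, if_false, le_refl]) <;>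
    split_ifs <;> omega

lemma redN_props {d a : ℕ} (hd : 4 ≤ d) (hd2 : d % 2 = 0) (ha : a < 2 * d)
    (h0 : a ≠ 0) (h1 : a ≠ 1) (h2 : a ≠ d) (h3 : a ≠ d + 1) :
    redN d a < 2 * (d - 2) ∧ colN (d-2) (redN d a) + 2 = colN d a ∧
      chiN (d-2) (redN d a) = chiN d a ∧ 2 ≤ colN d a ∧ colN d a < d := by
  unfold redN colN chiN
  rcases lt_or_ge a d with h | h
  · have h' : a - 2 < d - 2 := by omega
    simp only [h, h', if_true, and_true]; omega
  · have h' : ¬ (a - 4 < d - 2) := by omega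
    simp only [not_lt.mpr h, h', if_false]; omega

lemma redN_inj {d a b : ℕ} (hd : 4 ≤ d) (h0 : a ≠ 0) (h1 : a ≠ 1) (h2 : a ≠ d) (h3 : a ≠ d + 1)
    (h0' : b ≠ 0) (h1' : b ≠ 1) (h2' : b ≠ d) (h3' : b ≠ d + 1) (h : redN d a = redN d b) :
    a = b := by
  unfold redN at h
  split_ifs at h <;> omega

/-- monochromatic indicator -/
def monoN (d a b : ℕ) : ℕ := if chiN d a = chiN d b then 1 else 0

lemma costN_red {d a b : ℕ} (hd : 4 ≤ d) (hd2 : d % 2 = 0) (ha : a < 2 * d)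
    (h0 : a ≠ 0) (h1 : a ≠ 1) (h2 : a ≠ d) (h3 : a ≠ d + 1)
    (hb : b < 2 * d)
    (h0' : b ≠ 0) (h1' : b ≠ 1) (h2' : b ≠ d) (h3' : b ≠ d + 1) :
    costN (d-2) (redN d a) (redN d b) + 2 * monoN d a b = costN d a b := by
  obtain ⟨_, c1, e1, c3, c4⟩ := redN_props hd hd2 ha h0 h1 h2 h3
  obtain ⟨_, c1', e1', c3', c4'⟩ := redN_props hd hd2 hb h0' h1' h2' h3'
  unfold costN monoN
  rw [e1, e1']
  split_ifs <;> omega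

lemma mono_parity (d : ℕ) (b : ℕ → ℕ) (N : ℕ)
    (h : ∑ k ∈ Finset.range N, monoN d (b k) (b (k+1)) = 0) :
    (chiN d (b 0) + chiN d (b N) + N) % 2 = 0 := by
  induction N with
  | zero => omega
  | succ N ihN =>
    rw [Finset.sum_range_succ] at h
    have h1 := ihN (by omega)
    have h2 : monoN d (b N) (b (N+1)) = 0 := by omega
    unfold monoN at h2
    have := chiN_lt d (b N)
    have := chiN_lt d (b (N+1))
    split_ifs at h2
    omega

lemma core (d N : ℕ) (hd : 4 ≤ d) (hd2 : d % 2 = 0) (hN : N + 5 = 2 * d) (b : ℕ → ℕ)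
    (hb : ∀ k, b k < 2 * d) (hinj : ∀ i < N + 5, ∀ j < N + 5, b i = b j → i = j)
    (hb0 : b (N + 5) = b 0)
    (hcost : ∑ k ∈ Finset.range (N+5), costN d (b k) (b (k+1)) < 2 * d - 2)
    (ih : ∀ G : ℕ → ℕ, (∀ k, G k < 2 * (d-2)) → (∀ i < N + 1, ∀ j < N + 1, G i = G j → i = j) →
      G (N+1) = G 0 → 2 * (d - 2) - 2 ≤ ∑ k ∈ Finset.range (N+1), costN (d-2) (G k) (G (k+1)))
    (hconf : (b 0 = d ∧ b 1 = 0 ∧ b 2 = 1 ∧ b 3 = d + 1) ∨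
      (b 0 = 1 ∧ b 1 = 0 ∧ b 2 = d ∧ b 3 = d + 1) ∨
      (b 0 = 0 ∧ b 1 = 1 ∧ b 2 = d + 1 ∧ b 3 = d)) : False := by
  have hne : ∀ k, 4 ≤ k → k < N + 5 → b k ≠ 0 ∧ b k ≠ 1 ∧ b k ≠ d ∧ b k ≠ d + 1 := by
    intro k hk hk'
    have a0 : b k ≠ b 0 := fun h => by have := hinj _ hk' _ (by omega) h; omega
    have a1 : b k ≠ b 1 := fun h => by have := hinj _ hk' _ (by omega) h; omega
    have a2 : b k ≠ b 2 := fun h => by have := hinj _ hk' _ (by omega) h; omega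
    have a3 : b k ≠ b 3 := fun h => by have := hinj _ hk' _ (by omega) h; omega
    omega
  let G : ℕ → ℕ := fun k => if k < N + 1 then redN d (b (k+4)) else redN d (b 4)
  have hG := ih G ?_ ?_ ?_
  rotate_left
  · intro k
    simp only [G]
    split_ifs with h
    · obtain ⟨h0, h1, h2, h3⟩ := hne (k+4) (by omega) (by omega)
      exact (redN_props hd hd2 (hb _) h0 h1 h2 h3).1
    · obtain ⟨h0, h1, h2, h3⟩ := hne 4 (by omega) (by omega)
      exact (redN_props hd hd2 (hb _) h0 h1 h2 h3).1
  · intro i hi j hj h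
    simp only [G, hi, hj, if_true] at h
    obtain ⟨h0, h1, h2, h3⟩ := hne (i+4) (by omega) (by omega)
    obtain ⟨h0', h1', h2', h3'⟩ := hne (j+4) (by omega) (by omega)
    have := hinj _ (by omega) _ (by omega) (redN_inj hd h0 h1 h2 h3 h0' h1' h2' h3' h)
    omega
  · simp [G]
  rw [Finset.sum_range_succ] at hG
  have e1 : ∑ k ∈ Finset.range N, costN (d-2) (G k) (G (k+1)) +
      2 * ∑ k ∈ Finset.range N, monoN d (b (k+4)) (b (k+1+4)) =
      ∑ k ∈ Finset.range N, costN d (b (k+4)) (b (k+1+4)) := by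
    rw [Finset.mul_sum, ← Finset.sum_add_distrib]
    refine Finset.sum_congr rfl fun k hk => ?_
    have hk := Finset.mem_range.mp hk
    have hk1 : k < N + 1 := by omega
    have hk2 : k + 1 < N + 1 := by omega
    simp only [G, hk1, hk2, if_true]
    obtain ⟨h0, h1, h2, h3⟩ := hne (k+4) (by omega) (by omega)
    obtain ⟨h0', h1', h2', h3'⟩ := hne (k+1+4) (by omega) (by omega)
    exact costN_red hd hd2 (hb _) h0 h1 h2 h3 (hb _) h0' h1' h2' h3'
  have hpar := mono_parity d (fun k => b (k+4)) N
  have g1 : G N = redN d (b (N+4)) := by simp [G]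
  have g2 : G (N+1) = redN d (b 4) := by simp [G]
  rw [g1, g2] at hG
  rw [Finset.sum_range_succ, Finset.sum_range_succ', Finset.sum_range_succ',
    Finset.sum_range_succ', Finset.sum_range_succ', hb0] at hcost
  simp only [zero_add, Nat.reduceAdd, add_assoc] at hcost hpar e1
  have e2 : ∑ k ∈ Finset.range N, costN d (b (k+4)) (b (k+5)) =
     ∑ k ∈ Finset.range N, costN d (b (k+4)) (b (k+(1+4))) := rfl
  set S := ∑ k ∈ Finset.range N, costN d (b (k+4)) (b (k+5)) with hS
  set S' := ∑ k ∈ Finset.range N, costN (d-2) (G k) (G (k+1)) with hS'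
  set M := ∑ k ∈ Finset.range N, monoN d (b (k+4)) (b (k+5)) with hM
  obtain ⟨h0, h1, h2, h3⟩ := hne (N+4) (by omega) (by omega)
  obtain ⟨h0', h1', h2', h3'⟩ := hne 4 (by omega) (by omega)
  obtain ⟨_, c1, f1, c3, c4⟩ := redN_props hd hd2 (hb _) h0 h1 h2 h3
  obtain ⟨_, c1', f1', c3', c4'⟩ := redN_props hd hd2 (hb _) h0' h1' h2' h3'
  have k0 : colN d 0 = 0 := by unfold colN; split_ifs <;> omega
  have k1 : colN d 1 = 1 := by unfold colN; split_ifs <;> omega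
  have k2 : colN d d = 0 := by unfold colN; split_ifs <;> omega
  have k3 : colN d (d+1) = 1 := by unfold colN; split_ifs <;> omega
  have l0 : chiN d 0 = 0 := by unfold chiN; split_ifs <;> omega
  have l1 : chiN d 1 = 1 := by unfold chiN; split_ifs <;> omega
  have l2 : chiN d d = 1 := by unfold chiN; split_ifs <;> omega
  have l3 : chiN d (d+1) = 0 := by unfold chiN; split_ifs <;> omega
  have t1 := chiN_lt d (b 4)
  have t2 := chiN_lt d (b (N+4))
  rcases hconf with ⟨q0, q1, q2, q3⟩ | ⟨q0, q1, q2, q3⟩ | ⟨q0, q1, q2, q3⟩ <;>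
  rw [q0, q1, q2, q3] at hcost <;>
  clear_value S S' M <;>
  rcases t1 with t1 | t1 <;> rcases t2 with t2 | t2 <;>
  simp [costN, k0, k1, k2, k3, l0, l1, l2, l3, f1, f1', t1, t2] at hcost hG hpar <;> omega

lemma exists_fun {n : ℕ} [NeZero n] (hn : 3 ≤ n) (v : ZMod n)
    (w : (⊤ : SimpleGraph (ZMod n)).Walk v v) (hw : w.IsHamiltonianCycle) :
    ∃ f : ZMod n → ZMod n, Function.Injective f ∧
      ∀ e, e ∈ w.edges ↔ ∃ i, e = s(f i, f (i+1)) := by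
  have hlen : w.length = n := by rw [hw.length_eq, ZMod.card]
  have hsucc : ∀ i : ZMod n, w.getVert (i+1).val = w.getVert (i.val + 1) := by
    intro i
    have hi := ZMod.val_lt i
    by_cases h : i.val + 1 < n
    · rw [ZMod.val_add_of_lt] <;> rw [ZMod.val_one'' (by omega)]
      exact h
    · have h' : i.val + 1 = n := by omega
      have : i + 1 = 0 := by
        have : ((i.val + 1 : ℕ) : ZMod n) = 0 := by rw [h']; simp
        simpa using this
      have hl := w.getVert_length
      rw [hlen] at hl
      rw [this, h', hl, ZMod.val_zero, w.getVert_zero]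
  refine ⟨fun i => w.getVert i.val, ?_, ?_⟩
  · intro i j h
    have hi := ZMod.val_lt i
    have hj := ZMod.val_lt j
    exact ZMod.val_injective n (hw.isCycle.getVert_injOn' (by simp; omega) (by simp; omega) h)
  · intro e
    simp only [hsucc]
    rw [List.mem_iff_getElem]
    constructor
    · rintro ⟨k, hk, rfl⟩
      have hk' : k < n := by simpa [hlen] using hk
      refine ⟨(k : ZMod n), ?_⟩
      rw [SimpleGraph.Walk.getElem_edges, ZMod.val_cast_of_lt hk']
    · rintro ⟨i, rfl⟩
      have hi := ZMod.val_lt i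
      refine ⟨i.val, by simp [hlen, hi], ?_⟩
      rw [SimpleGraph.Walk.getElem_edges]

lemma two_ne {n : ℕ} (hn : 3 ≤ n) : (2 : ZMod n) ≠ 0 := by
  intro h
  have : ((2 : ℕ) : ZMod n) = 0 := by exact_mod_cast h
  rw [ZMod.natCast_eq_zero_iff] at this
  have := Nat.le_of_dvd (by omega) this
  omega

lemma sum_fun {n : ℕ} [NeZero n] (hn : 3 ≤ n) (E : List (Sym2 (ZMod n))) (f : ZMod n → ZMod n)
    (hf : Function.Injective f) (hE : ∀ e, e ∈ E ↔ ∃ i, e = s(f i, f (i+1)))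
    (c : Sym2 (ZMod n) → ℕ) :
    ∑ e ∈ E.toFinset, c e = ∑ k ∈ Finset.range n, c s(f (k : ZMod n), f ((k+1 : ℕ) : ZMod n)) := by
  have h1 : E.toFinset = Finset.univ.image (fun i : ZMod n => s(f i, f (i+1))) := by
    ext e; simp [hE, eq_comm]
  rw [h1, Finset.sum_image]
  · symm
    refine Finset.sum_bij (fun k _ => (k : ZMod n)) (by simp) ?_ ?_ ?_
    · intro a ha b hb h
      have := congrArg ZMod.val h
      rwa [ZMod.val_cast_of_lt (by simpa using ha), ZMod.val_cast_of_lt (by simpa using hb)] at this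
    · intro i _
      exact ⟨i.val, by simpa using ZMod.val_lt i, by simp⟩
    · intro k _; push_cast; rfl
  · intro i _ j _ h
    simp only [Sym2.eq_iff] at h
    rcases h with ⟨h, _⟩ | ⟨h, h'⟩
    · exact hf h
    · exfalso
      have a1 := hf h
      have a2 := hf h'
      rw [a1] at a2
      exact two_ne hn (by linear_combination a2)

lemma config_fun {n : ℕ} (E : List (Sym2 (ZMod n))) (f : ZMod n → ZMod n)
    (hf : Function.Injective f) (hE : ∀ e, e ∈ E ↔ ∃ i, e = s(f i, f (i+1)))
    (p0 p1 p2 p3 : ZMod n) (h02 : p0 ≠ p2) (h13 : p1 ≠ p3)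
    (h1 : s(p0, p1) ∈ E) (h2 : s(p1, p2) ∈ E) (h3 : s(p2, p3) ∈ E) :
    ∃ g : ZMod n → ZMod n, Function.Injective g ∧ (∀ e, e ∈ E ↔ ∃ i, e = s(g i, g (i+1))) ∧
      g 0 = p0 ∧ g 1 = p1 ∧ g 2 = p2 ∧ g 3 = p3 := by
  -- the two neighbours
  have nb : ∀ g : ZMod n → ZMod n, Function.Injective g → (∀ e, e ∈ E ↔ ∃ i, e = s(g i, g (i+1))) →
      ∀ i q, s(g i, q) ∈ E → q = g (i+1) ∨ q = g (i-1) := by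
    intro g hg hgE i q h
    obtain ⟨j, hj⟩ := (hgE _).mp h
    rw [Sym2.eq_iff] at hj
    rcases hj with ⟨a, b⟩ | ⟨a, b⟩
    · left; rw [b, hg a]
    · right; rw [b, hg a]; simp
  have fin : ∀ g : ZMod n → ZMod n, Function.Injective g →
      (∀ e, e ∈ E ↔ ∃ i, e = s(g i, g (i+1))) → g 1 = p1 → g 2 = p2 → g 0 = p0 ∧ g 3 = p3 := by
    intro g hg hgE g1 g2
    constructor
    · rcases nb g hg hgE 1 p0 (by rw [g1, Sym2.eq_swap]; exact h1) with h | h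
      · exfalso; apply h02; rw [h, ← g2]; congr 1; norm_num
      · rw [h]; simp
    · rcases nb g hg hgE 2 p3 (by rw [g2]; exact h3) with h | h
      · rw [h]; congr 1; norm_num
      · exfalso; apply h13; rw [h, ← g1]; congr 1; norm_num
  obtain ⟨i, hi⟩ := (hE _).mp h2
  rw [Sym2.eq_iff] at hi
  rcases hi with ⟨a, b⟩ | ⟨a, b⟩
  · let g : ZMod n → ZMod n := fun j => f (i + (j - 1))
    have hg : Function.Injective g := fun x y h => by
      have := hf h; linear_combination this
    have hgE : ∀ e, e ∈ E ↔ ∃ j, e = s(g j, g (j+1)) := by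
      intro e; rw [hE]
      constructor
      · rintro ⟨j, rfl⟩
        refine ⟨j - i + 1, ?_⟩
        simp only [g]; congr 2 <;> ring
      · rintro ⟨j, rfl⟩
        refine ⟨i + (j - 1), ?_⟩
        simp only [g]; congr 2; ring
    have g1 : g 1 = p1 := by simp [g, a]
    have g2 : g 2 = p2 := by simp only [g, b]; congr 1; ring
    obtain ⟨q0, q3⟩ := fin g hg hgE g1 g2
    exact ⟨g, hg, hgE, q0, g1, g2, q3⟩
  · let g : ZMod n → ZMod n := fun j => f (i + 2 - j)
    have hg : Function.Injective g := fun x y h => by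
      have := hf h; linear_combination -this
    have hgE : ∀ e, e ∈ E ↔ ∃ j, e = s(g j, g (j+1)) := by
      intro e; rw [hE]
      constructor
      · rintro ⟨j, rfl⟩
        refine ⟨i + 1 - j, ?_⟩
        rw [Sym2.eq_swap]
        simp only [g]; congr 2 <;> ring
      · rintro ⟨j, rfl⟩
        refine ⟨i + 1 - j, ?_⟩
        rw [Sym2.eq_swap]
        simp only [g]; congr 2 <;> ring
    have g1 : g 1 = p1 := by simp only [g, a]; congr 1; ring
    have g2 : g 2 = p2 := by simp only [g, b]; congr 1; ring
    obtain ⟨q0, q3⟩ := fin g hg hgE g1 g2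
    exact ⟨g, hg, hgE, q0, g1, g2, q3⟩

lemma walk_of_fun {V : Type*} (G : ℕ → V) (k : ℕ) (h : ∀ i < k, G i ≠ G (i+1)) :
    ∃ w : (⊤ : SimpleGraph V).Walk (G 0) (G k), w.length = k ∧ ∀ i ≤ k, w.getVert i = G i := by
  induction k generalizing G with
  | zero => exact ⟨.nil, rfl, fun i hi => by obtain rfl : i = 0 := by omega
                                             rfl⟩
  | succ k ihk =>
    obtain ⟨w, hw, hv⟩ := ihk (fun i => G (i+1)) (fun i hi => h (i+1) (by omega))
    refine ⟨.cons (v := G 1) (by simpa using h 0 (by omega)) w, by simp [hw], ?_⟩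
    intro i hi
    cases i with
    | zero => simp
    | succ i => simpa using hv i (by omega)

lemma ih_fun (m : ℕ) [NeZero m] (hm : 4 ≤ m) (c : Sym2 (ZMod m) → ℕ) (B : ℕ)
    (ih : ∀ (v : ZMod m) (w : (⊤ : SimpleGraph (ZMod m)).Walk v v),
        w.IsHamiltonianCycle → B ≤ ∑ e ∈ w.edges.toFinset, c e)
    (G : ℕ → ZMod m) (hinj : ∀ i < m, ∀ j < m, G i = G j → i = j) (hG : G m = G 0) :
    B ≤ ∑ k ∈ Finset.range m, c s(G k, G (k+1)) := by
  obtain ⟨w, hlen, hv⟩ := walk_of_fun G m (by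
    intro i hi h
    by_cases h' : i + 1 < m
    · have := hinj _ hi _ h' h; omega
    · have : i + 1 = m := by omega
      rw [this, hG] at h
      have := hinj _ hi _ (by omega) h; omega)
  obtain ⟨w, hlen, hv⟩ : ∃ w : (⊤ : SimpleGraph (ZMod m)).Walk (G 0) (G 0),
      w.length = m ∧ ∀ i ≤ m, w.getVert i = G i :=
    ⟨w.copy rfl hG, by simpa using hlen, by simpa using hv⟩
  have hnil : ¬ w.Nil := by
    rw [SimpleGraph.Walk.nil_iff_length_eq]; omega
  have hcyc : w.IsCycle := by
    rw [SimpleGraph.Walk.isCycle_iff_isPath_tail_and_le_length]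
    refine ⟨?_, by omega⟩
    rw [← SimpleGraph.Walk.IsPath.getVert_injOn_iff]
    have hl := SimpleGraph.Walk.length_tail_add_one hnil
    intro i hi j hj h
    simp only [Set.mem_setOf_eq] at hi hj
    simp only [SimpleGraph.Walk.getVert_tail] at h
    rw [hv _ (by omega), hv _ (by omega)] at h
    have key : ∀ a, 1 ≤ a → a ≤ m → ∃ a' < m, G a = G a' ∧ (a' = a ∨ (a = m ∧ a' = 0)) := by
      intro a ha ha'
      by_cases h : a < m
      · exact ⟨a, h, rfl, .inl rfl⟩
      · obtain rfl : a = m := by omega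
        exact ⟨0, by omega, hG, .inr ⟨rfl, rfl⟩⟩
    obtain ⟨a, ha, ha1, ha2⟩ := key (i+1) (by omega) (by omega)
    obtain ⟨b, hb, hb1, hb2⟩ := key (j+1) (by omega) (by omega)
    have := hinj a ha b hb (by rw [← ha1, ← hb1, h])
    omega
  have hham : w.IsHamiltonianCycle := by
    rw [SimpleGraph.Walk.isHamiltonianCycle_iff_isCycle_and_length_eq]
    exact ⟨hcyc, by rw [hlen, ZMod.card]⟩
  refine (ih _ w hham).trans ?_
  have hsub : w.edges.toFinset ⊆ (Finset.range m).image (fun k => s(G k, G (k+1))) := by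
    intro e he
    rw [List.mem_toFinset, List.mem_iff_getElem] at he
    obtain ⟨k, hk, rfl⟩ := he
    have hk' : k < m := by simpa [hlen] using hk
    rw [SimpleGraph.Walk.getElem_edges, hv _ (by omega), hv _ (by omega)]
    exact Finset.mem_image.mpr ⟨k, by simpa using hk', rfl⟩
  refine (Finset.sum_le_sum_of_subset hsub).trans ?_
  exact Finset.sum_image_le_of_nonneg (fun _ _ => Nat.zero_le _)

lemma noconf {n e : ℕ} (hne : n = 4 * e) (he : 2 ≤ e)
    (ih : ∀ m : ℕ, 4 ∣ m → 4 ≤ m → m < n →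
      ∀ (v : ZMod m) (w : (⊤ : SimpleGraph (ZMod m)).Walk v v),
        w.IsHamiltonianCycle →
        m - 2 ≤ ∑ e ∈ w.edges.toFinset, circCost (m / 2) e)
    (v : ZMod n) (w : (⊤ : SimpleGraph (ZMod n)).Walk v v)
    (hw : w.IsHamiltonianCycle)
    (hcost : ∑ e ∈ w.edges.toFinset, circCost (n / 2) e < n - 2)
    (u : ZMod n) (q0 q1 q2 q3 : ℕ) (hq : (q0 = 2 * e ∧ q1 = 0 ∧ q2 = 1 ∧ q3 = 2 * e + 1) ∨
      (q0 = 1 ∧ q1 = 0 ∧ q2 = 2 * e ∧ q3 = 2 * e + 1) ∨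
      (q0 = 0 ∧ q1 = 1 ∧ q2 = 2 * e + 1 ∧ q3 = 2 * e))
    (h1 : s(u + (q0 : ZMod n), u + (q1 : ZMod n)) ∈ w.edges)
    (h2 : s(u + (q1 : ZMod n), u + (q2 : ZMod n)) ∈ w.edges)
    (h3 : s(u + (q2 : ZMod n), u + (q3 : ZMod n)) ∈ w.edges) : False := by
  haveI : NeZero n := ⟨by omega⟩
  have hval : ∀ q : ℕ, q < n → (u + (q : ZMod n) - u).val = q := by
    intro q h; rw [add_sub_cancel_left, ZMod.val_cast_of_lt h]
  have hneq : ∀ q q' : ℕ, q < n → q' < n → q ≠ q' → u + (q : ZMod n) ≠ u + (q' : ZMod n) := by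
    intro q q' h h' hn h''
    apply hn
    rw [← hval q h, ← hval q' h', h'']
  obtain ⟨f, hf, hE⟩ := exists_fun (by omega) v w hw
  obtain ⟨g, hg, hgE, g0, g1, g2, g3⟩ := config_fun w.edges f hf hE _ _ _ _
    (hneq q0 q2 (by omega) (by omega) (by omega)) (hneq q1 q3 (by omega) (by omega) (by omega))
    h1 h2 h3
  rw [sum_fun (by omega) w.edges g hg hgE] at hcost
  have hn2 : n / 2 = 2 * e := by omega
  rw [hn2] at hcost
  simp only [circCost_eq (n := n) (d := 2 * e) (by omega) (by omega) u] at hcost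
  have hN : 4 * e - 5 + 5 = n := by omega
  refine core (2 * e) (4 * e - 5) (by omega) (by omega) (by omega)
    (fun k => (g (k : ZMod n) - u).val) ?_ ?_ ?_ ?_ ?_ ?_
  · intro k
    have := ZMod.val_lt (g (k : ZMod n) - u)
    omega
  · intro i hi j hj h
    have h' := hg (sub_left_injective (ZMod.val_injective n h))
    have := congrArg ZMod.val h'
    rwa [ZMod.val_cast_of_lt (by omega), ZMod.val_cast_of_lt (by omega)] at this
  · simp [hN]
  · rw [show Finset.range (4 * e - 5 + 5) = Finset.range n by rw [hN]]
    refine lt_of_lt_of_eq hcost (by omega)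
  · intro G hG1 hG2 hG3
    obtain ⟨m, hm⟩ : ∃ m, m = 4 * (e - 1) := ⟨_, rfl⟩
    haveI : NeZero m := ⟨by omega⟩
    have hm1 : 4 * e - 5 + 1 = m := by omega
    have hGm : ∀ k, ((G k : ZMod m)).val = G k := fun k =>
      ZMod.val_cast_of_lt (by have := hG1 k; omega)
    have := ih_fun m (by omega) (circCost (m / 2)) (m - 2)
      (ih m ⟨e - 1, hm⟩ (by omega) (by omega)) (fun k => (G k : ZMod m)) ?_ ?_
    · have hm2 : m / 2 = 2 * e - 2 := by omega
      rw [hm2] at this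
      simp only [circCost_eq (n := m) (d := 2 * e - 2) (by omega) (by omega) 0, sub_zero,
        hGm] at this
      rw [hm1]
      omega
    · intro i hi j hj h
      have h' := congrArg ZMod.val h
      simp only [hGm] at h'
      exact hG2 i (by omega) j (by omega) h'
    · rw [hm1] at hG3
      simp only [hG3]
  · have e0 : (g ((0 : ℕ) : ZMod n) - u).val = q0 := by
      rw [Nat.cast_zero, g0, hval _ (by omega)]
    have e1 : (g ((1 : ℕ) : ZMod n) - u).val = q1 := by
      rw [Nat.cast_one, g1, hval _ (by omega)]
    have e2 : (g ((2 : ℕ) : ZMod n) - u).val = q2 := by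
      rw [Nat.cast_ofNat, g2, hval _ (by omega)]
    have e3 : (g ((3 : ℕ) : ZMod n) - u).val = q3 := by
      rw [Nat.cast_ofNat, g3, hval _ (by omega)]
    simp only [e0, e1, e2, e3]
    exact hq

/-- Lemma 2 (technical lemma): let `n ≥ 8` be divisible by 4, and suppose (minimality)
that the circlet inequality holds for every smaller `m` divisible by 4.  Then any
Hamiltonian cycle on `ZMod n` of circlet cost `< n − 2` contains none of the three
configurations (Type A, B1, B2) at any vertex `u`, where `δ = n/2 = d`. -/
theorem circlet_lemma2 (n : ℕ) (hn : 8 ≤ n) (h4 : 4 ∣ n)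
    (ih : ∀ m : ℕ, 4 ∣ m → 4 ≤ m → m < n →
      ∀ (v : ZMod m) (w : (⊤ : SimpleGraph (ZMod m)).Walk v v),
        w.IsHamiltonianCycle →
        m - 2 ≤ ∑ e ∈ w.edges.toFinset, circCost (m / 2) e)
    (v : ZMod n) (w : (⊤ : SimpleGraph (ZMod n)).Walk v v)
    (hw : w.IsHamiltonianCycle)
    (hcost : ∑ e ∈ w.edges.toFinset, circCost (n / 2) e < n - 2)
    (u δ : ZMod n) (hδ : δ = ((n / 2 : ℕ) : ZMod n)) :
    ¬(s(u + δ, u) ∈ w.edges ∧ s(u, u + 1) ∈ w.edges ∧ s(u + 1, u + 1 + δ) ∈ w.edges) ∧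
    ¬(s(u + 1, u) ∈ w.edges ∧ s(u, u + δ) ∈ w.edges ∧ s(u + δ, u + 1 + δ) ∈ w.edges) ∧
    ¬(s(u, u + 1) ∈ w.edges ∧ s(u + 1, u + 1 + δ) ∈ w.edges ∧ s(u + 1 + δ, u + δ) ∈ w.edges) := by
  obtain ⟨e, he⟩ := h4
  have hn2 : n / 2 = 2 * e := by omega
  have key := noconf he (by omega) ih v w hw hcost u
  rw [hn2] at hδ
  subst hδ
  refine ⟨?_, ?_, ?_⟩
  · rintro ⟨h1, h2, h3⟩
    refine key (2 * e) 0 1 (2 * e + 1) (by simp) ?_ ?_ ?_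
    · simpa using h1
    · simpa using h2
    · push_cast at h3 ⊢
      rwa [show u + (2 * (e : ZMod n) + 1) = u + 1 + 2 * e by ring]
  · rintro ⟨h1, h2, h3⟩
    refine key 1 0 (2 * e) (2 * e + 1) (by simp) ?_ ?_ ?_
    · simpa using h1
    · simpa using h2
    · push_cast at h3 ⊢
      rwa [show u + (2 * (e : ZMod n) + 1) = u + 1 + 2 * e by ring]
  · rintro ⟨h1, h2, h3⟩
    refine key 0 1 (2 * e + 1) (2 * e) (by simp) ?_ ?_ ?_
    · simpa using h1
    · push_cast at h2 ⊢
      rwa [show u + (2 * (e : ZMod n) + 1) = u + 1 + 2 * e by ring]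
    · push_cast at h3 ⊢
      rwa [show u + (2 * (e : ZMod n) + 1) = u + 1 + 2 * e by ring]
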